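/- Let (u, p) be a weak solution of the HHMO model in the supercritical regime u* < u*₀. Then there is ignition of precipitation for arbitrarily large x: for every Y > 0, the essential supremum of p over the set {(x,t) : x ≥ Y, t ≥ 0} is strictly positive; in particular, there is no precipitation gap of infinite width. -/

import Mathlib

open MeasureTheory Filter Set

noncomputable section

/-- The precipitation-free self-similar solution `ψ(x,t)`. -/
def psi (α β x t : ℝ) : ℝ :=
  if 0 < t then
    (α * β / 2) * Real.exp (α ^ 2 / 4) *
      ∫ ζ in Set.Ioi (max (|x| / Real.sqrt t) α), Real.exp (-ζ ^ 2 / 4)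
  else 0

/-- The profile `Ψ(η)` in similarity coordinates. -/
def PsiP (α β η : ℝ) : ℝ :=
  (α * β / 2) * Real.exp (α ^ 2 / 4) * ∫ ζ in Set.Ioi (max η α), Real.exp (-ζ ^ 2 / 4)

/-- Regularity of a weak solution: `w` is the spatial derivative of `u - ψ`;
both are continuous on `ℝ × [0,∞)` and bounded on `ℝ × [0,T]` for every `T > 0`. -/
def AuxReg (α β : ℝ) (u w : ℝ → ℝ → ℝ) : Prop :=
  (∀ t ∈ Set.Ici (0:ℝ), ∀ x : ℝ, HasDerivAt (fun y => u y t - psi α β y t) (w x t) x) ∧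
  ContinuousOn (fun q : ℝ × ℝ => u q.1 q.2 - psi α β q.1 q.2) (Set.univ ×ˢ Set.Ici 0) ∧
  ContinuousOn (fun q : ℝ × ℝ => w q.1 q.2) (Set.univ ×ˢ Set.Ici 0) ∧
  ∀ T > (0:ℝ), ∃ C : ℝ, ∀ x : ℝ, ∀ t ∈ Set.Icc (0:ℝ) T,
    |u x t - psi α β x t| ≤ C ∧ |w x t| ≤ C

/-- A test function of class `C^{1,1}(ℝ × [0,T])`, vanishing for large `|x|` and at `t = T`,
together with its partial derivatives `φt`, `φx`. -/
def IsTestFun (T : ℝ) (φ φt φx : ℝ → ℝ → ℝ) : Prop :=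
  (∀ x : ℝ, ∀ t ∈ Set.Icc (0:ℝ) T,
    HasDerivWithinAt (fun s => φ x s) (φt x t) (Set.Icc 0 T) t) ∧
  (∀ x : ℝ, ∀ t ∈ Set.Icc (0:ℝ) T, HasDerivAt (fun y => φ y t) (φx x t) x) ∧
  ContinuousOn (fun q : ℝ × ℝ => φ q.1 q.2) (Set.univ ×ˢ Set.Icc 0 T) ∧
  ContinuousOn (fun q : ℝ × ℝ => φt q.1 q.2) (Set.univ ×ˢ Set.Icc 0 T) ∧
  ContinuousOn (fun q : ℝ × ℝ => φx q.1 q.2) (Set.univ ×ˢ Set.Icc 0 T) ∧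
  (∃ R : ℝ, ∀ x : ℝ, ∀ t ∈ Set.Icc (0:ℝ) T, R ≤ |x| → φ x t = 0) ∧
  (∀ x : ℝ, φ x T = 0)

/-- The weak form of the equation, relative to a given precipitation function `p` and
the spatial derivative `w` of `u - ψ`. -/
def WeakForm (α β : ℝ) (u p w : ℝ → ℝ → ℝ) : Prop :=
  ∀ T > (0:ℝ), ∀ φ φt φx : ℝ → ℝ → ℝ, IsTestFun T φ φt φx →
    (∫ t in Set.Ioc (0:ℝ) T, ∫ x : ℝ, φt x t * (u x t - psi α β x t))
      = ∫ t in Set.Ioc (0:ℝ) T, ∫ x : ℝ, (φx x t * w x t + p x t * u x t * φ x t)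

/-- A weak solution of the linear auxiliary problem with given precipitation function `p`. -/
def IsAuxSolution (α β : ℝ) (p u : ℝ → ℝ → ℝ) : Prop :=
  (∀ x t : ℝ, u (-x) t = u x t) ∧
  ∃ w : ℝ → ℝ → ℝ, AuxReg α β u w ∧ WeakForm α β u p w

/-- A weak solution `(u, p)` of the HHMO model. -/
def IsWeakSolution (α β ustar : ℝ) (u p : ℝ → ℝ → ℝ) : Prop :=
  (∀ x t : ℝ, u (-x) t = u x t) ∧
  (∀ x t : ℝ, p (-x) t = p x t) ∧
  Measurable (fun q : ℝ × ℝ => p q.1 q.2) ∧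
  (∀ x : ℝ, ∀ t ∈ Set.Ici (0:ℝ),
    (sSup ((fun s => u x s) '' Set.Icc 0 t) < ustar → p x t = 0) ∧
    (sSup ((fun s => u x s) '' Set.Icc 0 t) = ustar → p x t ∈ Set.Icc (0:ℝ) 1) ∧
    (ustar < sSup ((fun s => u x s) '' Set.Icc 0 t) → p x t = 1)) ∧
  (∀ x : ℝ, MonotoneOn (fun t => p x t) (Set.Ici (0:ℝ))) ∧
  ∃ w : ℝ → ℝ → ℝ, AuxReg α β u w ∧ WeakForm α β u p w

/-- Condition (P): the precipitation function depends only on `x` beyond the parabola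
`t = x²/α²`. -/
def CondP (α : ℝ) (p : ℝ → ℝ → ℝ) (pstar : ℝ → ℝ) : Prop :=
  Measurable pstar ∧
  ∀ᵐ x ∂(volume.restrict (Set.Ioi (0:ℝ))), ∀ t : ℝ, x ^ 2 / α ^ 2 < t → p x t = pstar x

/-- The admissible class `𝒜` of precipitation functions. -/
def IsAdmissible (p : ℝ → ℝ → ℝ) : Prop :=
  (∀ x t : ℝ, p (-x) t = p x t) ∧
  MeasureTheory.LocallyIntegrableOn (fun q : ℝ × ℝ => p q.1 q.2) (Set.Ioi 0 ×ˢ Set.Ici 0) ∧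
  ∀ T > (0:ℝ), ∃ R : ℝ, ∀ x ≥ R, ∀ t ∈ Set.Icc (0:ℝ) T, p x t = 0

/-- `u` converges uniformly, in parabolic similarity coordinates, to the profile `Φ`. -/
def ConvUnif (u : ℝ → ℝ → ℝ) (Φ : ℝ → ℝ) : Prop :=
  ∀ ε > (0:ℝ), ∃ T : ℝ, ∀ t ≥ T, ∀ η ≥ (0:ℝ), |u (η * Real.sqrt t) t - Φ η| < ε

/-- The error function. -/
def erf (x : ℝ) : ℝ := (2 / Real.sqrt Real.pi) * ∫ s in (0:ℝ)..x, Real.exp (-s ^ 2)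

/-- The complementary error function. -/
def erfc (x : ℝ) : ℝ := (2 / Real.sqrt Real.pi) * ∫ s in Set.Ioi x, Real.exp (-s ^ 2)

/-- Kummer's confluent hypergeometric function `M(a,b,z)` (real arguments). -/
def kummerM (a b z : ℝ) : ℝ :=
  ∑' n : ℕ, (Polynomial.eval a (ascPochhammer ℝ n) / Polynomial.eval b (ascPochhammer ℝ n))
    * z ^ n / (n.factorial : ℝ)

/-- `κ = (1 + √(4γ+1))/2`, the positive root of `κ(κ-1) = γ`. -/
def kappaOf (γ : ℝ) : ℝ := (1 + Real.sqrt (4 * γ + 1)) / 2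

/-- The value `u*_γ` determined by the derivative matching condition. -/
def ustarGamma (α β γ : ℝ) : ℝ :=
  (α * β / 2) *
    (kappaOf γ * kummerM (kappaOf γ / 2 + 1) (kappaOf γ + 1 / 2) (-α ^ 2 / 4) /
        (α * kummerM (kappaOf γ / 2) (kappaOf γ + 1 / 2) (-α ^ 2 / 4)) +
      Real.exp (-α ^ 2 / 4) / (Real.sqrt Real.pi * erfc (α / 2)))⁻¹

/-- The self-similar profile `Φ_γ`. -/
def Phi (α β γ η : ℝ) : ℝ :=
  if η < α then
    ustarGamma α β γ * η ^ kappaOf γ *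
      kummerM (kappaOf γ / 2) (kappaOf γ + 1 / 2) (-η ^ 2 / 4) /
      (α ^ kappaOf γ * kummerM (kappaOf γ / 2) (kappaOf γ + 1 / 2) (-α ^ 2 / 4))
  else ustarGamma α β γ * erfc (η / 2) / erfc (α / 2)

/-- The critical threshold `u*₀`. -/
def ustarZero (α β : ℝ) : ℝ :=
  (α * β * Real.sqrt Real.pi / 2) * Real.exp (α ^ 2 / 4) * erf (α / 2) * erfc (α / 2)

/-- The fundamental lemma of the calculus of variations for a first-order equation `m' = -k` on
`[0, T]` with zero initial value, tested against functions vanishing at `T`. -/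
lemma eq_neg_integral_of_forall_test {T : ℝ} (hT : 0 < T) {m k : ℝ → ℝ} (hm : Continuous m)
    (hk : IntervalIntegrable k volume 0 T)
    (h : ∀ χ χ' : ℝ → ℝ, (∀ t, HasDerivAt χ (χ' t) t) → Continuous χ' → χ T = 0 →
      ∫ t in (0 : ℝ)..T, χ' t * m t = ∫ t in (0 : ℝ)..T, χ t * k t) :
    ∀ t ∈ Icc (0 : ℝ) T, m t = -∫ s in (0 : ℝ)..t, k s := by
  set k₁ : ℝ → ℝ := (Ioc 0 T).indicator k with hk₁
  have hk₁i : Integrable k₁ :=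
    ((intervalIntegrable_iff_integrableOn_Ioc_of_le hT.le).1 hk).integrable_indicator
      measurableSet_Ioc
  set K : ℝ → ℝ := fun t => ∫ s in (0 : ℝ)..t, k₁ s with hK
  have hKc : Continuous K := intervalIntegral.continuous_primitive
    (fun a b => hk₁i.intervalIntegrable) 0
  have hKac : AbsolutelyContinuousOnInterval K 0 T :=
    hk₁i.intervalIntegrable.absolutelyContinuousOnInterval_intervalIntegral (by simp)
  set D : ℝ → ℝ := fun t => m t + K t with hD
  have hDc : Continuous D := hm.add hKc
  set χ : ℝ → ℝ := fun t => ∫ s in T..t, D s with hχ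
  have hχd : ∀ t, HasDerivAt χ (D t) t := fun t => hDc.integral_hasStrictDerivAt T t |>.hasDerivAt
  have hχac : AbsolutelyContinuousOnInterval χ 0 T :=
    (hDc.intervalIntegrable 0 T).absolutelyContinuousOnInterval_intervalIntegral (by simp)
  have hχT : χ T = 0 := by simp [hχ]
  have e1 := h χ D hχd hDc hχT
  have e2 : ∫ t in (0 : ℝ)..T, χ t * k t = ∫ t in (0 : ℝ)..T, χ t * deriv K t := by
    apply intervalIntegral.integral_congr_ae
    filter_upwards [hk₁i.intervalIntegrable (a := 0) (b := T) |>.ae_hasDerivAt_integral]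
      with t ht htm
    have := ht (uIoc_subset_uIcc htm) 0 (by simp)
    rw [this.deriv, hk₁, indicator_of_mem (by rwa [uIoc_of_le hT.le] at htm)]
  rw [e2, hχac.integral_mul_deriv_eq_deriv_mul hKac] at e1
  have hK0 : K 0 = 0 := by simp [hK]
  simp only [fun t => (hχd t).deriv, hχT, hK0, zero_mul, mul_zero, sub_zero, zero_sub] at e1
  have e3 : ∫ t in (0 : ℝ)..T, D t ^ 2 = 0 := by
    have : ∀ t, D t ^ 2 = D t * m t + D t * K t := fun t => by simp only [hD]; ring
    have i1 : IntervalIntegrable (fun t => D t * m t) volume 0 T :=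
      (hDc.mul hm).intervalIntegrable _ _
    have i2 : IntervalIntegrable (fun t => D t * K t) volume 0 T :=
      (hDc.mul hKc).intervalIntegrable _ _
    simp_rw [this]
    rw [intervalIntegral.integral_add i1 i2, e1]
    ring
  intro t ht
  have hDt : D t = 0 := by
    by_contra hne
    have : 0 < ∫ t in (0 : ℝ)..T, D t ^ 2 :=
      intervalIntegral.integral_pos hT (hDc.pow 2).continuousOn (fun x _ => sq_nonneg _)
        ⟨t, ht, by positivity⟩
    exact this.ne' e3
  have hKt : K t = ∫ s in (0 : ℝ)..t, k s := by
    apply intervalIntegral.integral_congr_ae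
    refine Eventually.of_forall fun s hs => ?_
    rw [uIoc_of_le ht.1] at hs
    have hs' : s ∈ Ioc 0 T := ⟨hs.1, hs.2.trans ht.2⟩
    rw [hk₁, indicator_of_mem hs']
  rw [← hKt]
  simp only [hD] at hDt
  linarith

lemma continuous_integral_mul_of_hasCompactSupport {X : Type*} [TopologicalSpace X]
    [FirstCountableTopology X] [LocallyCompactSpace X] {g : ℝ → ℝ} (hg : Continuous g)
    (hgc : HasCompactSupport g) {v : ℝ → X → ℝ} (hv : Continuous fun q : ℝ × X => v q.1 q.2) :
    Continuous fun s => ∫ x, g x * v x s := by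
  have h := continuous_parametric_integral_of_continuous (μ := volume)
    (f := fun (s : X) (x : ℝ) => g x * v x s)
    ((hg.comp continuous_snd).mul (hv.comp continuous_swap)) hgc.isCompact
  convert h using 2 with s
  refine (setIntegral_eq_integral_of_forall_compl_eq_zero fun x hx => ?_).symm
  simp [image_eq_zero_of_notMem_tsupport hx]

/-- A function `v` solving `v_t = v_xx - F` weakly with zero initial value satisfies the equation
integrated in time, after testing with a smooth compactly supported function of `x`. -/
lemma integral_mul_eq_of_weakForm {T C : ℝ} (hT : 0 < T) {v w F : ℝ → ℝ → ℝ}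
    (hv : Continuous fun q : ℝ × ℝ => v q.1 q.2) (hw : Continuous fun q : ℝ × ℝ => w q.1 q.2)
    (hvw : ∀ t ∈ Icc (0 : ℝ) T, ∀ x, HasDerivAt (fun y => v y t) (w x t) x)
    (hF : Measurable fun q : ℝ × ℝ => F q.1 q.2)
    (hFC : ∀ x, ∀ t ∈ Icc (0 : ℝ) T, |F x t| ≤ C)
    (hweak : ∀ φ φt φx : ℝ → ℝ → ℝ, IsTestFun T φ φt φx →
      (∫ t in Ioc (0 : ℝ) T, ∫ x, φt x t * v x t)
        = ∫ t in Ioc (0 : ℝ) T, ∫ x, (φx x t * w x t + F x t * φ x t))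
    {G : ℝ → ℝ} (hG : ContDiff ℝ 2 G) (hGc : HasCompactSupport G) :
    (∀ t ∈ Icc (0 : ℝ) T, IntervalIntegrable (fun s => ∫ x, G x * F x s) volume 0 t) ∧
    ∀ t ∈ Icc (0 : ℝ) T, ∫ x, G x * v x t
      = ∫ s in (0 : ℝ)..t, ((∫ x, deriv (deriv G) x * v x s) - ∫ x, G x * F x s) := by
  have hG1 : ContDiff ℝ 1 (deriv G) := hG.deriv' (n := 1)
  have hGd : ∀ x, HasDerivAt G (deriv G x) x := fun x =>
    (hG.differentiable (by norm_num) x).hasDerivAt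
  have hGdd : ∀ x, HasDerivAt (deriv G) (deriv (deriv G) x) x := fun x =>
    (hG1.differentiable (by norm_num) x).hasDerivAt
  have hG2 : Continuous (deriv (deriv G)) := hG1.continuous_deriv le_rfl
  have hvt : ∀ t, Continuous fun x => v x t :=
    fun t => hv.comp (by fun_prop : Continuous fun x : ℝ => (x, t))
  have hwt : ∀ t, Continuous fun x => w x t :=
    fun t => hw.comp (by fun_prop : Continuous fun x : ℝ => (x, t))
  have hmc := continuous_integral_mul_of_hasCompactSupport hG.continuous hGc hv
  have hmc2 := continuous_integral_mul_of_hasCompactSupport hG2 hGc.deriv.deriv hv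
  have hGi : Integrable G := hG.continuous.integrable_of_hasCompactSupport hGc
  have hFi : ∀ t ∈ Icc (0 : ℝ) T, Integrable (fun x => G x * F x t) := fun t ht => by
    refine hGi.mul_bdd (c := C) ?_ (Eventually.of_forall fun x => hFC x t ht)
    exact (hF.comp (by fun_prop : Measurable fun x : ℝ => (x, t))).aestronglyMeasurable
  have hk2 : ∀ t ∈ Icc (0 : ℝ) T, IntervalIntegrable (fun s => ∫ x, G x * F x s) volume 0 t := by
    intro t ht
    rw [intervalIntegrable_iff_integrableOn_Ioc_of_le ht.1]
    have hsm : StronglyMeasurable fun s => ∫ x, G x * F x s := by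
      have : Measurable fun q : ℝ × ℝ => G q.2 * F q.2 q.1 :=
        (hG.continuous.measurable.comp measurable_snd).mul (hF.comp measurable_swap)
      exact this.stronglyMeasurable.integral_prod_right'
    refine Measure.integrableOn_of_bounded (M := ∫ x, |G x| * C) (by simp)
      hsm.aestronglyMeasurable ?_
    filter_upwards [ae_restrict_mem measurableSet_Ioc] with s hs
    have hs' : s ∈ Icc (0 : ℝ) T := ⟨hs.1.le, hs.2.trans ht.2⟩
    refine norm_integral_le_of_norm_le (hGi.abs.mul_const C) (Eventually.of_forall fun x => ?_)
    rw [norm_mul]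
    exact mul_le_mul_of_nonneg_left (hFC x s hs') (norm_nonneg _)
  refine ⟨hk2, ?_⟩
  have key := eq_neg_integral_of_forall_test hT hmc
    (k := fun s => (∫ x, G x * F x s) - ∫ x, deriv (deriv G) x * v x s)
    ((hk2 T ⟨hT.le, le_rfl⟩).sub (hmc2.intervalIntegrable _ _)) ?_
  · intro t ht
    rw [key t ht, ← intervalIntegral.integral_neg]
    simp
  intro χ χ' hχ hχ' hχT
  obtain ⟨R, hR⟩ := hGc.isCompact.isBounded.subset_closedBall (0 : ℝ)
  have hχc : Continuous χ := continuous_iff_continuousAt.2 fun t => (hχ t).continuousAt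
  have htest : IsTestFun T (fun x t => χ t * G x) (fun x t => χ' t * G x)
      (fun x t => χ t * deriv G x) := by
    refine ⟨fun x t _ => ((hχ t).mul_const _).hasDerivWithinAt, fun x t _ => (hGd x).const_mul _,
      Continuous.continuousOn ?_, Continuous.continuousOn ?_, Continuous.continuousOn ?_,
      ⟨R + 1, fun x t _ hx => ?_⟩, fun x => by simp [hχT]⟩
    · exact (hχc.comp continuous_snd).mul (hG.continuous.comp continuous_fst)
    · exact (hχ'.comp continuous_snd).mul (hG.continuous.comp continuous_fst)
    · exact (hχc.comp continuous_snd).mul (hG1.continuous.comp continuous_fst)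
    · have : x ∉ tsupport G := fun hm => by
        have := hR hm
        rw [Metric.mem_closedBall, dist_zero_right, Real.norm_eq_abs] at this
        linarith
      simp [image_eq_zero_of_notMem_tsupport this]
  have := hweak _ _ _ htest
  rw [intervalIntegral.integral_of_le hT.le, intervalIntegral.integral_of_le hT.le]
  have e1 : ∀ t, ∫ x, χ' t * G x * v x t = χ' t * ∫ x, G x * v x t := fun t => by
    rw [← integral_const_mul]; simp only [mul_assoc]
  simp only [e1] at this
  rw [this]
  refine setIntegral_congr_fun measurableSet_Ioc fun t ht => ?_
  have ht' : t ∈ Icc (0 : ℝ) T := ⟨ht.1.le, ht.2⟩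
  have i1 : Integrable (fun x => deriv G x * w x t) :=
    (hG1.continuous.mul (hwt t)).integrable_of_hasCompactSupport hGc.deriv.mul_right
  have i2 : Integrable (fun x => deriv (deriv G) x * v x t) :=
    (hG2.mul (hvt t)).integrable_of_hasCompactSupport hGc.deriv.deriv.mul_right
  have i3 : Integrable (fun x => deriv G x * v x t) :=
    (hG1.continuous.mul (hvt t)).integrable_of_hasCompactSupport hGc.deriv.mul_right
  have ibp : ∫ x, deriv G x * w x t = -∫ x, deriv (deriv G) x * v x t :=
    integral_mul_deriv_eq_deriv_mul_of_integrable (fun x _ => hGdd x) (fun x _ => hvw t ht' x)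
      i1 i2 i3
  have e2 : ∀ x, χ t * deriv G x * w x t + F x t * (χ t * G x)
      = χ t * (deriv G x * w x t + G x * F x t) := fun x => by ring
  simp only [e2]
  rw [integral_const_mul, integral_add i1 (hFi t ht'), ibp]
  ring

lemma IsLocalMin.deriv_deriv_nonneg {f : ℝ → ℝ} {x : ℝ} (h : IsLocalMin f x)
    (hc : ContinuousAt f x) : 0 ≤ deriv (deriv f) x := by
  by_contra! hneg
  have hmax := isLocalMax_of_deriv_deriv_neg hneg h.deriv_eq_zero hc
  have hconst : f =ᶠ[nhds x] fun _ => f x := by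
    filter_upwards [h, hmax] with y h1 h2 using le_antisymm h2 h1
  have h1 : deriv f =ᶠ[nhds x] fun _ => 0 := by
    simpa using hconst.deriv
  have h2 : deriv (deriv f) x = 0 := by
    simpa using h1.deriv_eq
  exact hneg.ne h2

lemma abs_integral_mul_sub_le {ρ g : ℝ → ℝ} (hρ : Continuous ρ) (hρc : HasCompactSupport ρ)
    (hρ0 : ∀ y, 0 ≤ ρ y) (hρ1 : ∫ y, ρ y = 1) (hg : Continuous g) {c e : ℝ}
    (h : ∀ y, ρ y ≠ 0 → |g y - c| ≤ e) : |(∫ y, ρ y * g y) - c| ≤ e := by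
  have hi : Integrable ρ := hρ.integrable_of_hasCompactSupport hρc
  have hgi : Integrable fun y => ρ y * g y :=
    (hρ.mul hg).integrable_of_hasCompactSupport hρc.mul_right
  have e1 : (∫ y, ρ y * g y) - c = ∫ y, ρ y * (g y - c) := by
    simp only [mul_sub]
    rw [integral_sub hgi (hi.mul_const c), integral_mul_const, hρ1, one_mul]
  have e2 : ∫ y, ρ y * e = e := by rw [integral_mul_const, hρ1, one_mul]
  rw [e1, ← e2, ← Real.norm_eq_abs]
  refine norm_integral_le_of_norm_le (hi.mul_const e) (Eventually.of_forall fun y => ?_)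
  rw [norm_mul, Real.norm_of_nonneg (hρ0 y), Real.norm_eq_abs]
  by_cases hy : ρ y = 0
  · simp [hy]
  · exact mul_le_mul_of_nonneg_left (h y hy) (hρ0 y)

lemma hasDerivAt_integral_mul_comp_sub {ρ g : ℝ → ℝ} (hρ : ContDiff ℝ 1 ρ)
    (hρc : HasCompactSupport ρ) (hg : Continuous g) (x : ℝ) :
    HasDerivAt (fun x => ∫ y, ρ y * g (x - y)) (∫ y, deriv ρ y * g (x - y)) x :=
  hρc.hasDerivAt_convolution_left (ContinuousLinearMap.mul ℝ ℝ) hρ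
    (hg.locallyIntegrable (μ := volume)) x

/-- Comparison of a weak solution of `v_t = v_xx - F`, `v(·, 0) = 0`, with a nonnegative caloric
function `b`: if `F ≤ 0` wherever `v < -b`, then `v ≥ -b`. -/
lemma nonneg_add_of_weakForm {T C : ℝ} (hT : 0 < T) {v w F b : ℝ → ℝ → ℝ}
    (hv : Continuous fun q : ℝ × ℝ => v q.1 q.2) (hw : Continuous fun q : ℝ × ℝ => w q.1 q.2)
    (hvw : ∀ t ∈ Icc (0 : ℝ) T, ∀ x, HasDerivAt (fun y => v y t) (w x t) x)
    (hvC : ∀ x, ∀ t ∈ Icc (0 : ℝ) T, |v x t| ≤ C)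
    (hF : Measurable fun q : ℝ × ℝ => F q.1 q.2)
    (hFC : ∀ x, ∀ t ∈ Icc (0 : ℝ) T, |F x t| ≤ C)
    (hweak : ∀ φ φt φx : ℝ → ℝ → ℝ, IsTestFun T φ φt φx →
      (∫ t in Ioc (0 : ℝ) T, ∫ x, φt x t * v x t)
        = ∫ t in Ioc (0 : ℝ) T, ∫ x, (φx x t * w x t + F x t * φ x t))
    (hb : ContinuousOn (fun q : ℝ × ℝ => b q.1 q.2) (univ ×ˢ Icc 0 T))
    (hb0 : ∀ x, ∀ t ∈ Icc (0 : ℝ) T, 0 ≤ b x t)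
    (hbx : ∀ t ∈ Icc (0 : ℝ) T, ContDiff ℝ 2 fun x => b x t)
    (hbt : ∀ x, ∀ t ∈ Icc (0 : ℝ) T,
      HasDerivAt (fun s => b x s) (deriv (deriv fun y => b y t) x) t)
    (hsign : ∀ᵐ t ∂volume.restrict (Ioc (0 : ℝ) T), ∀ᵐ x, v x t + b x t < 0 → F x t ≤ 0) :
    ∀ x, ∀ t ∈ Icc (0 : ℝ) T, 0 ≤ v x t + b x t := by
  intro x₀ t₀ ht₀
  by_contra! hneg
  obtain ⟨σ, hσ, hσ0⟩ : ∃ σ, v x₀ t₀ + b x₀ t₀ = -σ ∧ 0 < σ :=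
    ⟨-(v x₀ t₀ + b x₀ t₀), by simp, by linarith⟩
  obtain ⟨ε, hε, hεσ, hεσ'⟩ : ∃ ε, 0 < ε ∧ ε ≤ σ / 4 ∧ ε * (1 + x₀ ^ 2 + 3 * t₀) ≤ σ / 4 := by
    have h1 : 1 ≤ 1 + x₀ ^ 2 + 3 * t₀ := by nlinarith [sq_nonneg x₀, ht₀.1]
    refine ⟨σ / 4 / (1 + x₀ ^ 2 + 3 * t₀), by positivity, div_le_self (by positivity) h1, ?_⟩
    rw [div_mul_cancel₀ _ (by positivity)]
  have hC0 : 0 ≤ C := (abs_nonneg _).trans (hvC 0 0 ⟨le_rfl, hT.le⟩)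
  obtain ⟨R, hRx, hRC⟩ : ∃ R, |x₀| ≤ R ∧ C ≤ ε * R ^ 2 := by
    have h1 : C = ε * (C / ε) := by field_simp
    have h2 : 0 ≤ C / ε := by positivity
    refine ⟨|x₀| + 1 + C / ε, by linarith, ?_⟩
    have h3 := abs_nonneg x₀
    conv_lhs => rw [h1]
    exact mul_le_mul_of_nonneg_left (by nlinarith) hε.le
  have hR0 : 0 ≤ R := (abs_nonneg _).trans hRx
  obtain ⟨δ, hδ, hδ1, hδv, hδb⟩ : ∃ δ > (0 : ℝ), δ ≤ 1 ∧
      (∀ x y t, t ∈ Icc (0 : ℝ) T → |x| ≤ R → |y| < δ → |v (x - y) t - v x t| ≤ ε / 4) ∧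
      (∀ x y t s, t ∈ Icc (0 : ℝ) T → s ∈ Icc (0 : ℝ) T → |x| ≤ R → |y| < δ → |s - t| < δ →
        |(v (x - y) s + b (x - y) s) - (v x t + b x t)| ≤ ε / 4) := by
    have hS : IsCompact (Icc (-(R + 1)) (R + 1) ×ˢ Icc (0 : ℝ) T) :=
      isCompact_Icc.prod isCompact_Icc
    have u1 := hS.uniformContinuousOn_of_continuous hv.continuousOn
    have u2 := hS.uniformContinuousOn_of_continuous
      (hv.continuousOn.add (hb.mono (prod_mono (subset_univ _) subset_rfl)))
    rw [Metric.uniformContinuousOn_iff] at u1 u2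
    obtain ⟨d1, hd1, h1⟩ := u1 (ε / 4) (by positivity)
    obtain ⟨d2, hd2, h2⟩ := u2 (ε / 4) (by positivity)
    have hmem : ∀ x y t, t ∈ Icc (0 : ℝ) T → |x| ≤ R → |y| < 1 →
        (x - y, t) ∈ Icc (-(R + 1)) (R + 1) ×ˢ Icc (0 : ℝ) T := by
      intro x y t ht hx hy
      rw [abs_le] at hx
      rw [abs_lt] at hy
      exact ⟨⟨by dsimp; linarith, by dsimp; linarith⟩, ht⟩
    refine ⟨min 1 (min d1 d2), by positivity, min_le_left _ _, ?_, ?_⟩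
    · intro x y t ht hx hy
      have hy1 := hy.trans_le (min_le_left _ _)
      have hy2 := hy.trans_le ((min_le_right _ _).trans (min_le_left _ _))
      refine (h1 (x - y, t) (hmem x y t ht hx hy1) (x, t)
        (by simpa using hmem x 0 t ht hx (by simp)) ?_).le
      rw [Prod.dist_eq]
      simpa [Real.dist_eq, hd1] using hy2
    · intro x y t s ht hs hx hy hst
      have hy1 := hy.trans_le (min_le_left _ _)
      have hy2 := hy.trans_le ((min_le_right _ _).trans (min_le_right _ _))
      have hs2 := hst.trans_le ((min_le_right _ _).trans (min_le_right _ _))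
      refine (h2 (x - y, s) (hmem x y s hs hx hy1) (x, t)
        (by simpa using hmem x 0 t ht hx (by simp)) ?_).le
      rw [Prod.dist_eq]
      exact max_lt (by simpa [Real.dist_eq] using hy2) (by simpa [Real.dist_eq] using hs2)
  let bump : ContDiffBump (0 : ℝ) := ⟨δ / 2, δ, by positivity, by linarith⟩
  set ρ : ℝ → ℝ := bump.normed volume with hρ
  have hρC : ContDiff ℝ 2 ρ := bump.contDiff_normed (n := 2)
  have hρs : HasCompactSupport ρ := bump.hasCompactSupport_normed
  have hρ0 : ∀ y, 0 ≤ ρ y := bump.nonneg_normed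
  have hρ1 : ∫ y, ρ y = 1 := bump.integral_normed
  have hρδ : ∀ y, ρ y ≠ 0 → |y| < δ := by
    intro y hy
    have : y ∈ Metric.ball (0 : ℝ) δ := by
      rw [← show Function.support ρ = Metric.ball (0 : ℝ) δ from bump.support_normed_eq]
      exact hy
    simpa using this
  have hρC1 : ContDiff ℝ 1 (deriv ρ) := hρC.deriv' (n := 1)
  have hρC2 : Continuous (deriv (deriv ρ)) := hρC1.continuous_deriv le_rfl
  have hvt : ∀ t, Continuous fun x => v x t :=
    fun t => hv.comp (by fun_prop : Continuous fun x : ℝ => (x, t))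
  have hvshift : Continuous fun q : ℝ × (ℝ × ℝ) => v (q.2.1 - q.1) q.2.2 :=
    hv.comp (by fun_prop : Continuous fun q : ℝ × (ℝ × ℝ) => (q.2.1 - q.1, q.2.2))
  set V : ℝ → ℝ → ℝ := fun x t => ∫ y, ρ y * v (x - y) t with hV
  set V₂ : ℝ → ℝ → ℝ := fun x t => ∫ y, deriv (deriv ρ) y * v (x - y) t with hV₂
  have hVc : Continuous fun q : ℝ × ℝ => V q.1 q.2 :=
    continuous_integral_mul_of_hasCompactSupport (v := fun y (q : ℝ × ℝ) => v (q.1 - y) q.2)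
      hρC.continuous hρs hvshift
  have hV₂c : Continuous fun q : ℝ × ℝ => V₂ q.1 q.2 :=
    continuous_integral_mul_of_hasCompactSupport (v := fun y (q : ℝ × ℝ) => v (q.1 - y) q.2)
      hρC2 hρs.deriv.deriv hvshift
  have hVC : ∀ x, ∀ t ∈ Icc (0 : ℝ) T, |V x t| ≤ C := by
    intro x t ht
    have := abs_integral_mul_sub_le hρC.continuous hρs hρ0 hρ1
      ((hvt t).comp (by fun_prop : Continuous fun y : ℝ => x - y)) (c := 0) (e := C)
      (fun y _ => by simpa using hvC (x - y) t ht)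
    simpa using this
  have hVv : ∀ x, ∀ t ∈ Icc (0 : ℝ) T, |x| ≤ R → |V x t - v x t| ≤ ε / 4 := by
    intro x t ht hx
    exact abs_integral_mul_sub_le hρC.continuous hρs hρ0 hρ1
      ((hvt t).comp (by fun_prop : Continuous fun y : ℝ => x - y))
      (fun y hy => hδv x y t ht hx (hρδ y hy))
  have hmass : ∀ x,
      (∀ t ∈ Icc (0 : ℝ) T, IntervalIntegrable (fun s => ∫ y, ρ (x - y) * F y s) volume 0 t) ∧
      ∀ t ∈ Icc (0 : ℝ) T, V x t
        = ∫ s in (0 : ℝ)..t, (V₂ x s - ∫ y, ρ (x - y) * F y s) := by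
    intro x
    obtain ⟨h1, h2⟩ := integral_mul_eq_of_weakForm hT hv hw hvw hF hFC hweak
      (G := fun y => ρ (x - y)) (hρC.comp (by fun_prop))
      (hρs.comp_homeomorph (Homeomorph.subLeft x))
    have d2 : deriv (deriv fun y => ρ (x - y)) = fun y => deriv (deriv ρ) (x - y) := by
      have d1 : (deriv fun y => ρ (x - y)) = fun y => -deriv ρ (x - y) := by
        funext y; exact deriv_comp_const_sub ρ x y
      funext y
      rw [d1, deriv.fun_neg, deriv_comp_const_sub (deriv ρ) x y, neg_neg]
    rw [d2] at h2
    refine ⟨h1, fun t ht => ?_⟩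
    have e1 : ∀ (k : ℝ → ℝ) s, ∫ y, k (x - y) * v y s = ∫ y, k y * v (x - y) s := by
      intro k s
      rw [← integral_sub_left_eq_self _ volume x]
      simp
    have h3 := h2 t ht
    simp only [e1] at h3
    exact h3
  have hV0 : ∀ x, V x 0 = 0 := fun x => by
    rw [(hmass x).2 0 ⟨le_rfl, hT.le⟩, intervalIntegral.integral_same]
  set Q : ℝ × ℝ → ℝ := fun q => V q.1 q.2 + b q.1 q.2 + ε * (1 + q.1 ^ 2 + 3 * q.2) with hQ
  have hQc : ContinuousOn Q (univ ×ˢ Icc 0 T) :=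
    (hVc.continuousOn.add hb).add (Continuous.continuousOn (by fun_prop))
  have hx₀ : (x₀, t₀) ∈ Icc (-R) R ×ˢ Icc (0 : ℝ) T := ⟨abs_le.1 hRx, ht₀⟩
  obtain ⟨⟨x₁, t₁⟩, ⟨hx₁, ht₁⟩, hmin⟩ :=
    (isCompact_Icc.prod isCompact_Icc : IsCompact (Icc (-R) R ×ˢ Icc (0 : ℝ) T)).exists_isMinOn
      ⟨_, hx₀⟩ (hQc.mono (prod_mono (subset_univ _) subset_rfl))
  dsimp only at hx₁ ht₁
  have hQ₁ : Q (x₁, t₁) < 0 := by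
    refine (hmin hx₀).trans_lt ?_
    have := (abs_le.1 (hVv x₀ t₀ ht₀ hRx)).2
    simp only [hQ]
    linarith
  have ht₁0 : 0 < t₁ := by
    refine ht₁.1.lt_of_ne fun h0 => ?_
    have h1 := hb0 x₁ t₁ ht₁
    have h2 := hV0 x₁
    rw [h0] at h2
    simp only [hQ, h2] at hQ₁
    nlinarith [sq_nonneg x₁, ht₁.1, mul_nonneg hε.le (sq_nonneg x₁), mul_nonneg hε.le ht₁.1]
  have hx₁R : x₁ ∈ Ioo (-R) R := by
    have hne : |x₁| ≠ R := fun h => by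
      have h1 := hb0 x₁ t₁ ht₁
      have h2 := (abs_le.1 (hVC x₁ t₁ ht₁)).1
      have h3 : x₁ ^ 2 = R ^ 2 := by rw [← h, sq_abs]
      simp only [hQ, h3] at hQ₁
      nlinarith [mul_nonneg hε.le ht₁.1]
    exact abs_lt.1 ((abs_le.2 hx₁).lt_of_ne hne)
  have hxx : 0 ≤ V₂ x₁ t₁ + deriv (deriv fun y => b y t₁) x₁ + ε * 2 := by
    have hb2 := hbx t₁ ht₁
    have hb1 : ContDiff ℝ 1 (deriv fun y => b y t₁) := hb2.deriv' (n := 1)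
    have hd1 : ∀ x, HasDerivAt (fun x => Q (x, t₁))
        ((∫ y, deriv ρ y * v (x - y) t₁) + deriv (fun y => b y t₁) x + ε * (2 * x)) x := by
      intro x
      refine ((hasDerivAt_integral_mul_comp_sub (hρC.of_le (by norm_num)) hρs (hvt t₁) x).add
        (hb2.differentiable (by norm_num) x).hasDerivAt).add ?_
      have := (((hasDerivAt_pow 2 x).const_add 1).add_const (3 * t₁)).const_mul ε
      simpa using this
    have hd2 : HasDerivAt (fun x => (∫ y, deriv ρ y * v (x - y) t₁) + deriv (fun y => b y t₁) x
        + ε * (2 * x)) (V₂ x₁ t₁ + deriv (deriv fun y => b y t₁) x₁ + ε * 2) x₁ := by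
      refine ((hasDerivAt_integral_mul_comp_sub hρC1 hρs.deriv (hvt t₁) x₁).add
        (hb1.differentiable (by norm_num) x₁).hasDerivAt).add ?_
      simpa using ((hasDerivAt_id x₁).const_mul 2).const_mul ε
    have hloc : IsLocalMin (fun x => Q (x, t₁)) x₁ := by
      filter_upwards [Icc_mem_nhds hx₁R.1 hx₁R.2] with x hx using hmin ⟨hx, ht₁⟩
    have := hloc.deriv_deriv_nonneg (hd1 x₁).continuousAt
    rwa [funext fun x => (hd1 x).deriv, hd2.deriv] at this
  have hF0 : ∀ᵐ s ∂volume.restrict (Ioc (0 : ℝ) T), |s - t₁| < δ →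
      ∫ y, ρ (x₁ - y) * F y s ≤ 0 := by
    filter_upwards [hsign, ae_restrict_mem measurableSet_Ioc] with s hs hsT hst
    refine integral_nonpos_of_ae ?_
    filter_upwards [hs] with y hy
    by_cases hρy : ρ (x₁ - y) = 0
    · simp [hρy]
    have h1 := (abs_le.1 (hδb x₁ (x₁ - y) t₁ s ht₁ ⟨hsT.1.le, hsT.2⟩ (abs_le.2 hx₁)
      (hρδ _ hρy) hst)).2
    rw [sub_sub_cancel] at h1
    have h2 := (abs_le.1 (hVv x₁ t₁ ht₁ (abs_le.2 hx₁))).1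
    simp only [hQ] at hQ₁
    refine mul_nonpos_of_nonneg_of_nonpos (hρ0 _) (hy ?_)
    nlinarith [mul_nonneg hε.le ht₁.1, mul_nonneg hε.le (sq_nonneg x₁)]
  have hV₂t : Continuous fun s => V₂ x₁ s :=
    hV₂c.comp (by fun_prop : Continuous fun s : ℝ => (x₁, s))
  have hev1 : ∀ᶠ s in nhds t₁, V₂ x₁ t₁ - ε / 4 < V₂ x₁ s :=
    hV₂t.continuousAt.eventually (lt_mem_nhds (by linarith))
  obtain ⟨r, hr, hrV⟩ := Metric.eventually_nhds_iff.1 hev1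
  obtain ⟨r', hr', hrb⟩ := Metric.eventually_nhds_iff.1
    ((hasDerivAt_iff_isLittleO.1 (hbt x₁ t₁ ht₁)).def (by positivity : 0 < ε / 4))
  obtain ⟨s, hs0, hst, hsr, hsr', hsδ⟩ : ∃ s, 0 ≤ s ∧ s < t₁ ∧ t₁ - s < r ∧ t₁ - s < r' ∧
      t₁ - s < δ := by
    have hh : 0 < min t₁ (min r (min r' δ)) := by positivity
    refine ⟨t₁ - min t₁ (min r (min r' δ)) / 2, ?_, by linarith, ?_, ?_, ?_⟩
    · linarith [min_le_left t₁ (min r (min r' δ))]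
    · linarith [min_le_right t₁ (min r (min r' δ)), min_le_left r (min r' δ)]
    · linarith [min_le_right t₁ (min r (min r' δ)), min_le_right r (min r' δ), min_le_left r' δ]
    · linarith [min_le_right t₁ (min r (min r' δ)), min_le_right r (min r' δ), min_le_right r' δ]
  have hsT : s ∈ Icc (0 : ℝ) T := ⟨hs0, hst.le.trans ht₁.2⟩
  have hVdiff : (t₁ - s) * (V₂ x₁ t₁ - ε / 4) ≤ V x₁ t₁ - V x₁ s := by
    have hi : ∀ t ∈ Icc (0 : ℝ) T, IntervalIntegrable
        (fun τ => V₂ x₁ τ - ∫ y, ρ (x₁ - y) * F y τ) volume 0 t := fun t ht =>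
      (hV₂t.intervalIntegrable _ _).sub ((hmass x₁).1 t ht)
    rw [(hmass x₁).2 t₁ ht₁, (hmass x₁).2 s hsT,
      intervalIntegral.integral_interval_sub_left (hi t₁ ht₁) (hi s hsT)]
    have hc : ∫ _ in s..t₁, (V₂ x₁ t₁ - ε / 4) = (t₁ - s) * (V₂ x₁ t₁ - ε / 4) := by
      rw [intervalIntegral.integral_const, smul_eq_mul]
    rw [← hc]
    refine intervalIntegral.integral_mono_ae_restrict hst.le (by simp)
      ((hi s hsT).symm.trans (hi t₁ ht₁)) ?_
    rw [Measure.restrict_congr_set Ioc_ae_eq_Icc.symm]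
    filter_upwards [ae_restrict_of_ae_restrict_of_subset (Ioc_subset_Ioc hs0 ht₁.2) hF0,
      ae_restrict_mem measurableSet_Ioc] with τ hτ hτm
    have hd : |τ - t₁| ≤ t₁ - s := by
      rw [abs_le]; constructor <;> linarith [hτm.1, hτm.2]
    have h1 := hτ (hd.trans_lt hsδ)
    have h2 := hrV (y := τ) (by rw [Real.dist_eq]; exact hd.trans_lt hsr)
    linarith
  have hbdiff : (t₁ - s) * (deriv (deriv fun y => b y t₁) x₁ - ε / 4) ≤ b x₁ t₁ - b x₁ s := by
    have h1 := hrb (y := s) (by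
      rw [Real.dist_eq, abs_sub_comm, abs_of_pos (by linarith)]
      exact hsr')
    rw [Real.norm_eq_abs, Real.norm_eq_abs, abs_sub_comm s t₁, abs_of_pos (sub_pos.2 hst),
      abs_le, smul_eq_mul] at h1
    linarith [h1.2]
  have hQs := hmin (a := (x₁, s)) ⟨hx₁, hsT⟩
  simp only [hQ, mem_ofPred_eq] at hQs
  nlinarith [mul_pos (sub_pos.2 hst) hε, mul_nonneg (sub_pos.2 hst).le hxx]

lemma hasDerivAt_erf (r : ℝ) :
    HasDerivAt erf ((2 / Real.sqrt Real.pi) * Real.exp (-r ^ 2)) r := by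
  have hc : Continuous fun s : ℝ => Real.exp (-s ^ 2) := by fun_prop
  exact (hc.integral_hasStrictDerivAt 0 r).hasDerivAt.const_mul _

lemma continuous_erf : Continuous erf :=
  continuous_iff_continuousAt.2 fun r => (hasDerivAt_erf r).continuousAt

lemma contDiff_erf : ContDiff ℝ 2 erf := by
  rw [show (2 : WithTop ℕ∞) = 1 + 1 by norm_num, contDiff_succ_iff_deriv]
  refine ⟨fun r => (hasDerivAt_erf r).differentiableAt, by simp, ?_⟩
  rw [funext fun r => (hasDerivAt_erf r).deriv]
  fun_prop

lemma monotone_erf : Monotone erf :=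
  monotone_of_hasDerivAt_nonneg hasDerivAt_erf fun r => by
    show 0 ≤ _
    positivity

lemma erf_nonpos {r : ℝ} (hr : r ≤ 0) : erf r ≤ 0 := by
  simpa [erf] using monotone_erf hr

lemma erf_add_erfc (r : ℝ) : erf r + erfc r = 1 := by
  have hi : Integrable fun s : ℝ => Real.exp (-s ^ 2) := by
    simpa using integrable_exp_neg_mul_sq (b := 1) one_pos
  have hg : ∫ s in Ioi (0 : ℝ), Real.exp (-s ^ 2) = Real.sqrt Real.pi / 2 := by
    simpa using integral_gaussian_Ioi 1
  rw [erf, erfc, ← mul_add,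
    intervalIntegral.integral_interval_add_Ioi hi.integrableOn hi.integrableOn, hg]
  have : Real.sqrt Real.pi ≠ 0 := by positivity
  field_simp

lemma erf_le_one (r : ℝ) : erf r ≤ 1 := by
  have h : 0 ≤ erfc r :=
    mul_nonneg (by positivity) (setIntegral_nonneg measurableSet_Ioi fun s _ => by positivity)
  linarith [erf_add_erfc r]

/-- The caloric barrier with values between `0` and `2K`, which is at least `K` for `x ≤ Y`. -/
def erfBarrier (K Y x t : ℝ) : ℝ := K * (1 - erf ((x - Y) / (2 * Real.sqrt (t + 1))))

lemma contDiff_erfBarrier (K Y t : ℝ) : ContDiff ℝ 2 fun x => erfBarrier K Y x t :=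
  contDiff_const.mul (contDiff_const.sub (contDiff_erf.comp (by fun_prop)))

lemma continuousOn_erfBarrier (K Y : ℝ) :
    ContinuousOn (fun q : ℝ × ℝ => erfBarrier K Y q.1 q.2) (univ ×ˢ Ici 0) := by
  refine continuousOn_const.mul (continuousOn_const.sub (continuous_erf.comp_continuousOn ?_))
  refine ContinuousOn.div (by fun_prop) (by fun_prop) fun q hq => ?_
  have : (0 : ℝ) < q.2 + 1 := by linarith [show (0 : ℝ) ≤ q.2 from hq.2]
  positivity

lemma hasDerivAt_erfBarrier_heat (K Y x : ℝ) {t : ℝ} (ht : 0 ≤ t) :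
    HasDerivAt (fun s => erfBarrier K Y x s)
      (deriv (deriv fun y => erfBarrier K Y y t) x) t := by
  have ht1 : 0 < t + 1 := by linarith
  have hs : 0 < Real.sqrt (t + 1) := Real.sqrt_pos.2 ht1
  have hsq : Real.sqrt (t + 1) ^ 2 = t + 1 := Real.sq_sqrt ht1.le
  set q := Real.sqrt (t + 1) with hq
  set c := 2 / Real.sqrt Real.pi with hc
  have hlin : ∀ y, HasDerivAt (fun y => (y - Y) / (2 * q)) (1 / (2 * q)) y := fun y =>
    ((hasDerivAt_id y).sub_const Y).div_const _
  have d1 : ∀ y, HasDerivAt (fun y => erfBarrier K Y y t)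
      (K * -(c * Real.exp (-((y - Y) / (2 * q)) ^ 2) * (1 / (2 * q)))) y := fun y =>
    (((hasDerivAt_erf _).comp y (hlin y)).const_sub 1).const_mul K
  have d2 : HasDerivAt (fun y => K * -(c * Real.exp (-((y - Y) / (2 * q)) ^ 2) * (1 / (2 * q))))
      (K * -(c * (Real.exp (-((x - Y) / (2 * q)) ^ 2) *
        -(2 * ((x - Y) / (2 * q)) * (1 / (2 * q)))) * (1 / (2 * q)))) x := by
    have h1 := (((hlin x).fun_pow 2).fun_neg.exp.const_mul c).mul_const (1 / (2 * q))
    simpa using h1.fun_neg.const_mul K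
  rw [funext fun y => (d1 y).deriv, d2.deriv]
  have hsqrt : HasDerivAt (fun s => Real.sqrt (s + 1)) (1 / (2 * q)) t :=
    ((hasDerivAt_id t).add_const 1).sqrt ht1.ne'
  have hr : HasDerivAt (fun s => (x - Y) / (2 * Real.sqrt (s + 1)))
      (-((x - Y) * (2 * (1 / (2 * q)))) / (2 * q) ^ 2) t := by
    have := (hasDerivAt_const t (x - Y)).fun_div (hsqrt.const_mul 2) (by positivity)
    simpa using this
  have := (((hasDerivAt_erf _).comp t hr).const_sub 1).const_mul K
  refine HasDerivAt.congr_deriv this ?_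
  rw [← hq, ← hc]
  field_simp

lemma erfBarrier_nonneg {K : ℝ} (hK : 0 ≤ K) (Y x t : ℝ) : 0 ≤ erfBarrier K Y x t :=
  mul_nonneg hK (sub_nonneg.2 (erf_le_one _))

lemma le_erfBarrier {K Y x : ℝ} (hK : 0 ≤ K) (hx : x ≤ Y) (t : ℝ) : K ≤ erfBarrier K Y x t := by
  have : erf ((x - Y) / (2 * Real.sqrt (t + 1))) ≤ 0 :=
    erf_nonpos (div_nonpos_of_nonpos_of_nonneg (by linarith) (by positivity))
  unfold erfBarrier
  nlinarith

lemma integrable_exp_neg_sq_div_four : Integrable fun ζ : ℝ => Real.exp (-ζ ^ 2 / 4) := by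
  convert integrable_exp_neg_mul_sq (b := 1 / 4) (by norm_num) using 3
  ring

lemma continuous_gaussian_tail : Continuous fun r : ℝ => ∫ ζ in Ioi r, Real.exp (-ζ ^ 2 / 4) := by
  have hi := integrable_exp_neg_sq_div_four
  have : (fun r : ℝ => ∫ ζ in Ioi r, Real.exp (-ζ ^ 2 / 4)) = fun r =>
      (∫ ζ in Ioi 0, Real.exp (-ζ ^ 2 / 4)) - ∫ ζ in (0 : ℝ)..r, Real.exp (-ζ ^ 2 / 4) := by
    funext r
    have := intervalIntegral.integral_interval_add_Ioi (a := 0) (b := r)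
      hi.integrableOn hi.integrableOn
    linarith
  rw [this]
  exact continuous_const.sub
    (intervalIntegral.continuous_primitive (fun a b => hi.intervalIntegrable) 0)

lemma gaussian_tail_eq (α : ℝ) :
    ∫ ζ in Ioi α, Real.exp (-ζ ^ 2 / 4) = Real.sqrt Real.pi * erfc (α / 2) := by
  have h := integral_comp_mul_left_Ioi (fun ζ : ℝ => Real.exp (-ζ ^ 2 / 4)) (α / 2)
    (b := 2) two_pos
  have e : ∀ s : ℝ, -(2 * s) ^ 2 / 4 = -s ^ 2 := fun s => by ring
  simp only [e, smul_eq_mul, mul_div_cancel₀ α (two_ne_zero' ℝ)] at h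
  have hp : Real.sqrt Real.pi ≠ 0 := by positivity
  rw [erfc, h]
  field_simp

lemma psi_nonneg {α β : ℝ} (hα : 0 < α) (hβ : 0 < β) (x t : ℝ) : 0 ≤ psi α β x t := by
  unfold psi
  split_ifs
  · exact mul_nonneg (by positivity)
      (setIntegral_nonneg measurableSet_Ioi fun s _ => by positivity)
  · rfl

lemma PsiP_zero_nonneg {α β : ℝ} (hα : 0 < α) (hβ : 0 < β) : 0 ≤ PsiP α β 0 :=
  mul_nonneg (by positivity) (setIntegral_nonneg measurableSet_Ioi fun s _ => by positivity)

lemma psi_le_PsiP_zero {α β : ℝ} (hα : 0 < α) (hβ : 0 < β) (x t : ℝ) :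
    psi α β x t ≤ PsiP α β 0 := by
  unfold psi
  split_ifs
  · refine mul_le_mul_of_nonneg_left ?_ (by positivity)
    refine setIntegral_mono_set integrable_exp_neg_sq_div_four.integrableOn
      (Eventually.of_forall fun s => by show 0 ≤ _; positivity) (Eventually.of_forall ?_)
    exact Ioi_subset_Ioi (max_le_max_right _ (by positivity))
  · exact PsiP_zero_nonneg hα hβ

lemma measurable_psi (α β : ℝ) : Measurable fun q : ℝ × ℝ => psi α β q.1 q.2 := by
  unfold psi
  refine Measurable.ite (measurableSet_lt measurable_const measurable_snd) ?_ measurable_const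
  refine measurable_const.mul (continuous_gaussian_tail.measurable.comp ?_)
  fun_prop

lemma continuous_psi (α β : ℝ) {t : ℝ} (ht : 0 < t) : Continuous fun x => psi α β x t := by
  simp only [psi, ht, if_true]
  exact continuous_const.mul (continuous_gaussian_tail.comp (by fun_prop))

lemma psi_mul_self_sq {α β s : ℝ} (hα : 0 < α) (hs : 0 < s) :
    psi α β (α * s) (s ^ 2) = PsiP α β 0 := by
  rw [psi, if_pos (by positivity), PsiP, Real.sqrt_sq hs.le, abs_of_pos (by positivity),
    mul_div_cancel_right₀ _ hs.ne', max_self, max_eq_right hα.le]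

lemma PsiP_zero_mul_erf {α β : ℝ} (hα : 0 < α) :
    PsiP α β 0 * erf (α / 2) = ustarZero α β := by
  rw [PsiP, max_eq_right hα.le, gaussian_tail_eq, ustarZero]
  ring

/-- If precipitation vanishes almost everywhere beyond `Y`, a weak solution is bounded below by
`ψ` minus the `erfBarrier` with amplitude `Ψ(0)` placed at `Y`. -/
lemma psi_le_add_erfBarrier {α β Y : ℝ} (hα : 0 < α) (hβ : 0 < β) {u p : ℝ → ℝ → ℝ}
    (hp : Measurable fun q : ℝ × ℝ => p q.1 q.2)
    (hp01 : ∀ x, ∀ t ∈ Ici (0 : ℝ), p x t ∈ Icc (0 : ℝ) 1)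
    (hpY : ∀ᵐ q : ℝ × ℝ, Y ≤ q.1 ∧ 0 ≤ q.2 → p q.1 q.2 ≤ 0)
    {w : ℝ → ℝ → ℝ} (hreg : AuxReg α β u w) (hweak : WeakForm α β u p w) :
    ∀ x, ∀ t ∈ Ici (0 : ℝ), psi α β x t ≤ u x t + erfBarrier (PsiP α β 0) Y x t := by
  obtain ⟨hd, hvc, hwc, hbd⟩ := hreg
  have hK := PsiP_zero_nonneg hα hβ
  set v : ℝ → ℝ → ℝ := fun x t => u x (max t 0) - psi α β x (max t 0) with hv
  have hvt : ∀ x, ∀ t ∈ Ici (0 : ℝ), v x t = u x t - psi α β x t := fun x t ht => by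
    simp only [hv, max_eq_left (mem_Ici.1 ht)]
  have hcomp : Continuous fun q : ℝ × ℝ => (q.1, max q.2 0) := by fun_prop
  have hvcont : Continuous fun q : ℝ × ℝ => v q.1 q.2 :=
    hvc.comp_continuous hcomp fun q => ⟨mem_univ _, mem_Ici.2 (le_max_right _ _)⟩
  have hwcont : Continuous fun q : ℝ × ℝ => w q.1 (max q.2 0) :=
    hwc.comp_continuous hcomp fun q => ⟨mem_univ _, mem_Ici.2 (le_max_right _ _)⟩
  intro x t ht
  have hT : (0 : ℝ) < t + 1 := by linarith [mem_Ici.1 ht]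
  obtain ⟨C, hC⟩ := hbd (t + 1) hT
  have hIci : ∀ s ∈ Icc (0 : ℝ) (t + 1), s ∈ Ici (0 : ℝ) := fun s hs => hs.1
  have main := nonneg_add_of_weakForm (T := t + 1) (C := C + PsiP α β 0) hT
    (v := v) (w := fun x t => w x (max t 0)) (F := fun x t => p x t * (v x t + psi α β x t))
    (b := erfBarrier (PsiP α β 0) Y) hvcont hwcont ?_ ?_ ?_ ?_ ?_
    ((continuousOn_erfBarrier _ _).mono (prod_mono subset_rfl Icc_subset_Ici_self))
    (fun x s _ => erfBarrier_nonneg hK Y x s) (fun s _ => contDiff_erfBarrier _ _ s)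
    (fun x s hs => hasDerivAt_erfBarrier_heat _ _ x hs.1) ?_ x t ⟨ht, by linarith⟩
  · rw [hvt x t ht] at main
    linarith
  · intro s hs y
    simp only [hv, max_eq_left hs.1]
    exact hd s hs.1 y
  · intro y s hs
    rw [hvt y s hs.1]
    linarith [(hC y s hs).1]
  · exact hp.mul (hvcont.measurable.add (measurable_psi α β))
  · intro y s hs
    have h1 := hp01 y s hs.1
    have h2 : |v y s + psi α β y s| ≤ C + PsiP α β 0 := by
      refine (abs_add_le _ _).trans (add_le_add ?_ ?_)
      · rw [hvt y s hs.1]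
        exact (hC y s hs).1
      · rw [abs_of_nonneg (psi_nonneg hα hβ y s)]
        exact psi_le_PsiP_zero hα hβ y s
    rw [abs_mul, abs_of_nonneg h1.1]
    exact (mul_le_of_le_one_left (abs_nonneg _) h1.2).trans h2
  · intro φ φt φx hφ
    have := hweak (t + 1) hT φ φt φx hφ
    convert this using 1
    · refine setIntegral_congr_fun measurableSet_Ioc fun s hs => ?_
      simp only [hvt _ s hs.1.le]
    · refine setIntegral_congr_fun measurableSet_Ioc fun s hs => ?_
      simp only [hvt _ s hs.1.le, sub_add_cancel, max_eq_left hs.1.le]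
  · have hswap : ∀ᵐ q : ℝ × ℝ, Y ≤ q.2 ∧ 0 ≤ q.1 → p q.2 q.1 ≤ 0 :=
      (Measure.measurePreserving_swap (μ := (volume : Measure ℝ))
        (ν := (volume : Measure ℝ))).quasiMeasurePreserving.ae hpY
    filter_upwards [ae_restrict_of_ae (Measure.ae_ae_of_ae_prod hswap),
      ae_restrict_mem measurableSet_Ioc] with s hs hsT
    filter_upwards [hs] with y hy hneg
    have h1 := hp01 y s hsT.1.le
    rcases le_total Y y with hYy | hyY
    · have h0 : p y s = 0 := le_antisymm (hy ⟨hYy, hsT.1.le⟩) h1.1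
      simp [h0]
    · have h2 := le_erfBarrier hK hyY s
      have h3 := psi_le_PsiP_zero hα hβ y s
      exact mul_nonpos_of_nonneg_of_nonpos h1.1 (by linarith)

/-- In the supercritical regime, the lower bound `ψ - erfBarrier` exceeds `u*` along the parabola
`x = α √t` for large times. -/
lemma exists_lt_of_psi_le_add_erfBarrier {α β ustar Y : ℝ} (hα : 0 < α) (hβ : 0 < β) (hY : 0 < Y)
    (hsup : ustar < ustarZero α β) {u : ℝ → ℝ → ℝ}
    (h : ∀ x, ∀ t ∈ Ici (0 : ℝ), psi α β x t ≤ u x t + erfBarrier (PsiP α β 0) Y x t) :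
    ∃ x t, Y < x ∧ 0 < t ∧ ustar < u x t := by
  have hK := PsiP_zero_nonneg hα hβ
  have hlim : ∀ᶠ r in nhds (α / 2), ustar < PsiP α β 0 * erf r := by
    have hc : Continuous fun r => PsiP α β 0 * erf r := continuous_const.mul continuous_erf
    rw [← PsiP_zero_mul_erf hα] at hsup
    exact hc.continuousAt.eventually (lt_mem_nhds hsup)
  obtain ⟨r, hr, hr0, hrα⟩ : ∃ r, ustar < PsiP α β 0 * erf r ∧ 0 < r ∧ r < α / 2 := by
    have hI : Ioo 0 (α / 2) ∈ nhdsWithin (α / 2) (Iio (α / 2)) := Ioo_mem_nhdsLT (by positivity)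
    obtain ⟨r, h1, h2⟩ := ((hlim.filter_mono nhdsWithin_le_nhds).and hI).exists
    exact ⟨r, h1, h2.1, h2.2⟩
  have hgap : 0 < α - 2 * r := by linarith
  set s := (Y + 2 * r) / (α - 2 * r) with hs
  have hs0 : 0 < s := by positivity
  have hs1 : (α - 2 * r) * s = Y + 2 * r := mul_div_cancel₀ _ hgap.ne'
  refine ⟨α * s, s ^ 2, by nlinarith, by positivity, hr.trans_le ?_⟩
  have h1 := h (α * s) (s ^ 2) (mem_Ici.2 (by positivity))
  have hsqrt : Real.sqrt (s ^ 2 + 1) ≤ s + 1 := by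
    rw [Real.sqrt_le_left (by positivity)]
    nlinarith
  have h2 : r ≤ (α * s - Y) / (2 * Real.sqrt (s ^ 2 + 1)) := by
    rw [le_div_iff₀ (by positivity)]
    nlinarith
  have h3 := mul_le_mul_of_nonneg_left (monotone_erf h2) hK
  rw [psi_mul_self_sq hα hs0, erfBarrier] at h1
  linarith

/-- no precipitation gap of infinite width in the supercritical regime
`u* < u*₀`: for every `Y > 0` the essential supremum of `p` over
`{(x,t) : x ≥ Y, t ≥ 0}` is strictly positive. -/
theorem no_gap_of_infinite_width_supercritical (α β ustar : ℝ) (hα : 0 < α) (hβ : 0 < β)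
    (hu : 0 < ustar) (hsup : ustar < ustarZero α β)
    (u p : ℝ → ℝ → ℝ) (hsol : IsWeakSolution α β ustar u p) :
    ∀ Y : ℝ, 0 < Y →
      0 < essSup (fun q : ℝ × ℝ => p q.1 q.2)
        ((volume : Measure (ℝ × ℝ)).restrict {q : ℝ × ℝ | Y ≤ q.1 ∧ 0 ≤ q.2}) := by
  intro Y hY
  obtain ⟨-, -, hp, hpu, -, w, hreg, hweak⟩ := hsol
  have hp01 : ∀ x, ∀ t ∈ Ici (0 : ℝ), p x t ∈ Icc (0 : ℝ) 1 := by
    intro x t ht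
    obtain ⟨h1, h2, h3⟩ := hpu x t ht
    rcases lt_trichotomy (sSup ((fun s => u x s) '' Icc 0 t)) ustar with h | h | h
    · simp [h1 h]
    · exact h2 h
    · simp [h3 h]
  have hS : MeasurableSet {q : ℝ × ℝ | Y ≤ q.1 ∧ 0 ≤ q.2} :=
    (measurableSet_le measurable_const measurable_fst).inter
      (measurableSet_le measurable_const measurable_snd)
  by_contra! hess
  have hbdd : IsBoundedUnder (· ≤ ·)
      (ae ((volume : Measure (ℝ × ℝ)).restrict {q : ℝ × ℝ | Y ≤ q.1 ∧ 0 ≤ q.2}))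
      (fun q : ℝ × ℝ => p q.1 q.2) := by
    refine isBoundedUnder_of_eventually_le (a := 1) ?_
    filter_upwards [ae_restrict_mem hS] with q hq using (hp01 q.1 q.2 hq.2).2
  have hpY : ∀ᵐ q : ℝ × ℝ, Y ≤ q.1 ∧ 0 ≤ q.2 → p q.1 q.2 ≤ 0 := by
    refine (ae_restrict_iff' hS).1 ?_
    filter_upwards [ae_le_essSup hbdd] with q hq using hq.trans hess
  obtain ⟨x, t, hYx, ht, hxt⟩ := exists_lt_of_psi_le_add_erfBarrier hα hβ hY hsup
    (psi_le_add_erfBarrier hα hβ hp hp01 hpY hreg hweak)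
  have hucont : Continuous fun y => u y t := by
    have h1 : Continuous fun y => u y t - psi α β y t :=
      continuous_iff_continuousAt.2 fun y => (hreg.1 t ht.le y).continuousAt
    have h2 : Continuous fun y => (u y t - psi α β y t) + psi α β y t :=
      h1.add (continuous_psi α β ht)
    simpa using h2
  set O : Set ℝ := {y | ustar < u y t} ∩ Ioi Y with hO
  have hOo : IsOpen O := (isOpen_lt continuous_const hucont).inter isOpen_Ioi
  have hpos : 0 < (volume : Measure (ℝ × ℝ)) (O ×ˢ Ioi t) :=
    (hOo.prod isOpen_Ioi).measure_pos volume ⟨(x, t + 1), ⟨hxt, hYx⟩, by simp⟩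
  refine hpos.ne' (measure_mono_null ?_ (ae_iff.1 hpY))
  rintro ⟨y, s⟩ ⟨⟨hyu, hyY⟩, hs⟩
  have hts : t < s := hs
  have hs0 : 0 < s := ht.trans hts
  obtain ⟨C, hC⟩ := hreg.2.2.2 s hs0
  have hBdd : BddAbove ((fun τ => u y τ) '' Icc 0 s) := by
    refine ⟨C + PsiP α β 0, ?_⟩
    rintro _ ⟨τ, hτ, rfl⟩
    have h1 := (abs_le.1 (hC y τ hτ).1).2
    have h2 := psi_le_PsiP_zero hα hβ y τ
    dsimp only
    linarith
  have hle : u y t ≤ sSup ((fun τ => u y τ) '' Icc 0 s) :=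
    le_csSup hBdd ⟨t, ⟨ht.le, hts.le⟩, rfl⟩
  have hp1 : p y s = 1 := (hpu y s hs0.le).2.2 (lt_of_lt_of_le hyu hle)
  intro hcon
  have h0 : p y s ≤ 0 := hcon ⟨(mem_Ioi.1 hyY).le, hs0.le⟩
  linarith

end
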